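/- Fix k ∈ (0, π), γ ≠ 0, and θ_i ≤ θ_f in (−π/2, π/2). For θ ∈ (−π/2, π/2) define α(θ) = π·sin k·√(γ² + tan²θ) and the unit vector n(θ) = (γ, 0, tan θ)/√(γ² + tan²θ) ∈ ℝ³. For N ≥ 1 set θ_j = θ_i + ((2j−1)/(2N))·(θ_f − θ_i) for j = 1,…,N. Then the sums Φ_N = (1/2)·Σ_{j=1}^{N−1} α(θ_j)·α(θ_{j+1})·[ y-component of n(θ_{j+1}) × n(θ_j) ] converge as N → ∞ to (π²/2)·γ·sin²k·(tan θ_f − tan θ_i). -/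

import Mathlib

open Set Filter
open scoped Topology

/-- Large-`N` limit of the synthesized counterdiabatic rotation angle in
the geo-jump protocol: with kick angles `α(θ) = π sin k √(γ² + tan²θ)`, axes
`n(θ) = (γ, 0, tanθ)/√(γ² + tan²θ)`, and midpoints `θ_j = θ_i + ((2j−1)/(2N))(θ_f − θ_i)`,
the sums `Φ_N = (1/2)·Σ_{j=1}^{N−1} α(θ_j)α(θ_{j+1})·(n(θ_{j+1}) × n(θ_j))_y` converge to
`(π²/2)·γ·sin²k·(tanθ_f − tanθ_i)` as `N → ∞`. -/
theorem geo_jump_counterdiabatic_angle_limit (k γ θi θf : ℝ)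
    (hk : k ∈ Ioo 0 Real.pi) (hγ : γ ≠ 0) (hif : θi ≤ θf)
    (hθi : θi ∈ Ioo (-(Real.pi / 2)) (Real.pi / 2))
    (hθf : θf ∈ Ioo (-(Real.pi / 2)) (Real.pi / 2))
    (α : ℝ → ℝ) (hα : ∀ θ : ℝ, α θ = Real.pi * Real.sin k * Real.sqrt (γ ^ 2 + Real.tan θ ^ 2))
    (n : ℝ → Fin 3 → ℝ)
    (hn : ∀ θ : ℝ, n θ =
      ![γ / Real.sqrt (γ ^ 2 + Real.tan θ ^ 2), 0,
        Real.tan θ / Real.sqrt (γ ^ 2 + Real.tan θ ^ 2)])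
    (θj : ℕ → ℕ → ℝ)
    (hθj : ∀ N j : ℕ, θj N j = θi + ((2 * (j : ℝ) - 1) / (2 * (N : ℝ))) * (θf - θi))
    (Φ : ℕ → ℝ)
    (hΦ : ∀ N : ℕ, Φ N = (1 / 2) *
      ∑ j ∈ Finset.Icc 1 (N - 1),
        α (θj N j) * α (θj N (j + 1)) * crossProduct (n (θj N (j + 1))) (n (θj N j)) 1) :
    Tendsto Φ atTop
      (𝓝 ((Real.pi ^ 2 / 2) * γ * Real.sin k ^ 2 * (Real.tan θf - Real.tan θi))) := by
  have hterm : ∀ a b : ℝ, α a * α b * crossProduct (n b) (n a) 1 =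
      Real.pi ^ 2 * Real.sin k ^ 2 * γ * (Real.tan b - Real.tan a) := by
    intro a b
    have hpos : ∀ θ : ℝ, Real.sqrt (γ ^ 2 + Real.tan θ ^ 2) ≠ 0 := fun θ => by
      have : 0 < γ ^ 2 := by positivity
      positivity
    have ha := hpos a
    have hb := hpos b
    rw [hα, hα, hn, hn, cross_apply]
    simp only [Matrix.cons_val]
    generalize Real.sqrt (γ ^ 2 + Real.tan a ^ 2) = x at *
    generalize Real.sqrt (γ ^ 2 + Real.tan b ^ 2) = y at *
    field_simp
  have htel : ∀ (f : ℕ → ℝ) (m : ℕ),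
      ∑ j ∈ Finset.Icc 1 m, (f (j + 1) - f j) = f (m + 1) - f 1 := by
    intro f m
    induction m with
    | zero => simp
    | succ m ih => rw [Finset.sum_Icc_succ_top (by omega), ih]; ring
  have hΦ' : ∀ N : ℕ, 1 ≤ N → Φ N = (Real.pi ^ 2 / 2) * γ * Real.sin k ^ 2 *
      (Real.tan (θf - (θf - θi) / 2 * (N : ℝ)⁻¹) -
        Real.tan (θi + (θf - θi) / 2 * (N : ℝ)⁻¹)) := by
    intro N hN
    have hN0 : (N : ℝ) ≠ 0 := by positivity
    rw [hΦ]
    simp only [hterm]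
    rw [← Finset.mul_sum, htel (fun j => Real.tan (θj N j)), Nat.sub_add_cancel hN]
    have h1 : θj N N = θf - (θf - θi) / 2 * (N : ℝ)⁻¹ := by
      rw [hθj]; field_simp; ring
    have h2 : θj N 1 = θi + (θf - θi) / 2 * (N : ℝ)⁻¹ := by
      rw [hθj]; push_cast; field_simp; ring
    rw [h1, h2]; ring
  have hinv : Tendsto (fun N : ℕ => (θf - θi) / 2 * (N : ℝ)⁻¹) atTop (𝓝 0) := by
    simpa using (tendsto_inv_atTop_nhds_zero_nat (𝕜 := ℝ)).const_mul ((θf - θi) / 2)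
  have hc : ∀ θ ∈ Ioo (-(Real.pi / 2)) (Real.pi / 2), ContinuousAt Real.tan θ := fun θ h =>
    Real.continuousAt_tan.2 (Real.cos_pos_of_mem_Ioo h).ne'
  have l1 : Tendsto (fun N : ℕ => θf - (θf - θi) / 2 * (N : ℝ)⁻¹) atTop (𝓝 θf) := by
    simpa using hinv.const_sub θf
  have l2 : Tendsto (fun N : ℕ => θi + (θf - θi) / 2 * (N : ℝ)⁻¹) atTop (𝓝 θi) := by
    simpa using hinv.const_add θi
  refine Tendsto.congr' ?_ ((((hc θf hθf).tendsto.comp l1).sub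
    ((hc θi hθi).tendsto.comp l2)).const_mul _)
  filter_upwards [eventually_ge_atTop 1] with N hN
  rw [hΦ' N hN]
  rfl
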